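/- Let X⊕X'' →M Y⊕Y'' →[v₁' v₂'] Z' →(w₁';w₂') ΣX⊕ΣX'' be a distinguished triangle, where M is the matrix [[u, c],[0, u'']] for some morphisms u: X→Y, c: X''→Y, u'': X''→Y'', and let X'' →u'' Y'' →v'' Z'' →w'' ΣX'' be a distinguished triangle. Suppose h: Z'→Z'' is such that the triple (proj_{X''}, proj_{Y''}, h), whose first, second, and fourth vertical components are the canonical direct-summand projections X⊕X''→X'', Y⊕Y''→Y'', ΣX⊕ΣX''→ΣX'', is a map of triangles. Then the following are equivalent: (a) this map of triangles is good; (b) it is Verdier good; (c) the candidate triangle Z' →(w₁';h) ΣX⊕Z'' →[Σu, (Σc)∘w''] ΣY →Σv₁' ΣZ' is a distinguished triangle. Moreover, if c = 0, then these conditions hold for every such h. -/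

import Mathlib

open CategoryTheory Category Limits Pretriangulated

universe v u

variable {C : Type u} [Category.{v} C] [Preadditive C] [HasZeroObject C]
  [HasShift C ℤ] [∀ n : ℤ, (shiftFunctor C n).Additive] [Pretriangulated C]
  [IsTriangulated C] [HasBinaryBiproducts C]

noncomputable local instance (n : ℤ) : PreservesBinaryBiproducts (shiftFunctor C n) :=
  preservesBinaryBiproducts_of_preservesBiproducts _

/-- The condition that `(f, g, h)` is a morphism of triangles from `T` to `T'`. -/
def IsTriMap (T T' : Triangle C) (f : T.obj₁ ⟶ T'.obj₁) (g : T.obj₂ ⟶ T'.obj₂)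
    (h : T.obj₃ ⟶ T'.obj₃) : Prop :=
  T.mor₁ ≫ g = f ≫ T'.mor₁ ∧ T.mor₂ ≫ h = g ≫ T'.mor₂ ∧
    T.mor₃ ≫ f⟦(1 : ℤ)⟧' = h ≫ T'.mor₃

/-- The mapping cone of a morphism of triangles. -/
noncomputable def mappingCone (T T' : Triangle C) (f : T.obj₁ ⟶ T'.obj₁)
    (g : T.obj₂ ⟶ T'.obj₂) (h : T.obj₃ ⟶ T'.obj₃) : Triangle C :=
  Triangle.mk
    (biprod.desc (biprod.lift T'.mor₁ 0) (biprod.lift g (-T.mor₂)) :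
      T'.obj₁ ⊞ T.obj₂ ⟶ T'.obj₂ ⊞ T.obj₃)
    (biprod.desc (biprod.lift T'.mor₂ 0) (biprod.lift h (-T.mor₃)) :
      T'.obj₂ ⊞ T.obj₃ ⟶ T'.obj₃ ⊞ T.obj₁⟦(1 : ℤ)⟧)
    (biprod.desc (biprod.lift T'.mor₃ 0)
        (biprod.lift (f⟦(1 : ℤ)⟧') (-(T.mor₁⟦(1 : ℤ)⟧'))) ≫
      ((shiftFunctor C (1 : ℤ)).mapBiprod T'.obj₁ T.obj₂).inv)

/-- A morphism of triangles is good if its mapping cone is distinguished. -/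
noncomputable def IsGood (T T' : Triangle C) (f : T.obj₁ ⟶ T'.obj₁)
    (g : T.obj₂ ⟶ T'.obj₂) (h : T.obj₃ ⟶ T'.obj₃) : Prop :=
  mappingCone T T' f g h ∈ distTriang C

/-- An octahedron on composable maps `a`, `b`, given distinguished triangles
`(a, p₁, q₁)`, `(b, p₂, q₂)` and `(a ≫ b, p₃, q₃)`, is a pair `(m, n)` as below. -/
def IsOctahedron {A₁ A₂ A₃ B₁ B₂ B₃ : C} (a : A₁ ⟶ A₂) (b : A₂ ⟶ A₃)
    (p₁ : A₂ ⟶ B₁) (q₁ : B₁ ⟶ A₁⟦(1 : ℤ)⟧)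
    (p₂ : A₃ ⟶ B₂) (q₂ : B₂ ⟶ A₂⟦(1 : ℤ)⟧)
    (p₃ : A₃ ⟶ B₃) (q₃ : B₃ ⟶ A₁⟦(1 : ℤ)⟧)
    (m : B₁ ⟶ B₃) (n : B₃ ⟶ B₂) : Prop :=
  p₁ ≫ m = b ≫ p₃ ∧ m ≫ q₃ = q₁ ∧ p₃ ≫ n = p₂ ∧ n ≫ q₂ = q₃ ≫ a⟦(1 : ℤ)⟧' ∧
    (Triangle.mk m n (q₂ ≫ p₁⟦(1 : ℤ)⟧') ∈ distTriang C)

/-- A morphism of triangles `(f, g, h)` is Verdier good if `h` arises from Verdier's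
construction via two octahedra on the composite `g ∘ u = u' ∘ f`. -/
def IsVerdierGood (T T' : Triangle C) (f : T.obj₁ ⟶ T'.obj₁) (g : T.obj₂ ⟶ T'.obj₂)
    (h : T.obj₃ ⟶ T'.obj₃) : Prop :=
  ∃ (A Y'' X'' : C) (vt : T'.obj₂ ⟶ A) (wt : A ⟶ T.obj₁⟦(1 : ℤ)⟧)
    (g' : T'.obj₂ ⟶ Y'') (g'' : Y'' ⟶ T.obj₂⟦(1 : ℤ)⟧)
    (f' : T'.obj₁ ⟶ X'') (f'' : X'' ⟶ T.obj₁⟦(1 : ℤ)⟧)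
    (α₁ : T.obj₃ ⟶ A) (β₁ : A ⟶ Y'') (α₂ : X'' ⟶ A) (β₂ : A ⟶ T'.obj₃),
    (Triangle.mk (T.mor₁ ≫ g) vt wt ∈ distTriang C) ∧
    (Triangle.mk g g' g'' ∈ distTriang C) ∧
    (Triangle.mk f f' f'' ∈ distTriang C) ∧
    IsOctahedron T.mor₁ g T.mor₂ T.mor₃ g' g'' vt wt α₁ β₁ ∧
    IsOctahedron f T'.mor₁ f' f'' T'.mor₂ T'.mor₃ vt wt α₂ β₂ ∧
    h = α₁ ≫ β₂

/-- The morphism of triangles `(f, g, h)` is nullhomotopic, in the (equivalent)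
`Σ`-applied formulation of the first equation. -/
def IsNullHomotopic (T T' : Triangle C) (f : T.obj₁ ⟶ T'.obj₁) (g : T.obj₂ ⟶ T'.obj₂)
    (h : T.obj₃ ⟶ T'.obj₃) : Prop :=
  ∃ (F : T.obj₂ ⟶ T'.obj₁) (G : T.obj₃ ⟶ T'.obj₂) (H : T.obj₁⟦(1 : ℤ)⟧ ⟶ T'.obj₃),
    f⟦(1 : ℤ)⟧' = T.mor₁⟦(1 : ℤ)⟧' ≫ F⟦(1 : ℤ)⟧' + H ≫ T'.mor₃ ∧
    g = T.mor₂ ≫ G + F ≫ T'.mor₁ ∧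
    h = T.mor₃ ≫ H + G ≫ T'.mor₂

/-- A triangle is contractible if its identity morphism is nullhomotopic. -/
def IsContractible (T : Triangle C) : Prop :=
  IsNullHomotopic T T (𝟙 T.obj₁) (𝟙 T.obj₂) (𝟙 T.obj₃)

/-- A morphism of triangles is middling good if it extends to a 4 × 4 diagram. -/
def IsMiddlingGood (T T' : Triangle C) (f : T.obj₁ ⟶ T'.obj₁) (g : T.obj₂ ⟶ T'.obj₂)
    (h : T.obj₃ ⟶ T'.obj₃) : Prop :=
  ∃ (X'' Y'' Z'' : C)
    (f' : T'.obj₁ ⟶ X'') (f'' : X'' ⟶ T.obj₁⟦(1 : ℤ)⟧)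
    (g' : T'.obj₂ ⟶ Y'') (g'' : Y'' ⟶ T.obj₂⟦(1 : ℤ)⟧)
    (h' : T'.obj₃ ⟶ Z'') (h'' : Z'' ⟶ T.obj₃⟦(1 : ℤ)⟧)
    (u'' : X'' ⟶ Y'') (v'' : Y'' ⟶ Z'') (w'' : Z'' ⟶ X''⟦(1 : ℤ)⟧),
    (Triangle.mk f f' f'' ∈ distTriang C) ∧
    (Triangle.mk g g' g'' ∈ distTriang C) ∧
    (Triangle.mk h h' h'' ∈ distTriang C) ∧
    (Triangle.mk u'' v'' w'' ∈ distTriang C) ∧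
    T'.mor₁ ≫ g' = f' ≫ u'' ∧
    T'.mor₂ ≫ h' = g' ≫ v'' ∧
    T'.mor₃ ≫ f'⟦(1 : ℤ)⟧' = h' ≫ w'' ∧
    u'' ≫ g'' = f'' ≫ T.mor₁⟦(1 : ℤ)⟧' ∧
    v'' ≫ h'' = g'' ≫ T.mor₂⟦(1 : ℤ)⟧' ∧
    h'' ≫ T.mor₃⟦(1 : ℤ)⟧' = -(w'' ≫ f''⟦(1 : ℤ)⟧')

/-- A candidate triangle `(a, b, c)` is replaceably exact if each of its three maps
can be replaced to give a distinguished triangle. -/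
def ReplaceablyExact {A B D : C} (a : A ⟶ B) (b : B ⟶ D) (c : D ⟶ A⟦(1 : ℤ)⟧) : Prop :=
  (∃ a' : A ⟶ B, Triangle.mk a' b c ∈ distTriang C) ∧
  (∃ b' : B ⟶ D, Triangle.mk a b' c ∈ distTriang C) ∧
  (∃ c' : D ⟶ A⟦(1 : ℤ)⟧, Triangle.mk a b c' ∈ distTriang C)

set_option linter.unusedSectionVars false

namespace CategoryTheory.Pretriangulated

/-- A biproduct, in the category of candidate triangles, of two distinguished triangles is
distinguished. -/
lemma distinguished_of_biproduct {T T₁ T₂ : Triangle C} (h₁ : T₁ ∈ distTriang C)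
    (h₂ : T₂ ∈ distTriang C) (i₁ : T₁ ⟶ T) (i₂ : T₂ ⟶ T) (p₁ : T ⟶ T₁) (p₂ : T ⟶ T₂)
    (h₁₁ : i₁ ≫ p₁ = 𝟙 _) (h₁₂ : i₁ ≫ p₂ = 0) (h₂₁ : i₂ ≫ p₁ = 0) (h₂₂ : i₂ ≫ p₂ = 𝟙 _)
    (total : p₁ ≫ i₁ + p₂ ≫ i₂ = 𝟙 T) : T ∈ distTriang C := by
  let F : WalkingPair → Triangle C := fun j => WalkingPair.casesOn j T₁ T₂
  let π₁ : productTriangle F ⟶ T₁ := productTriangle.π F WalkingPair.left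
  let π₂ : productTriangle F ⟶ T₂ := productTriangle.π F WalkingPair.right
  let φ : ∀ j, T ⟶ F j := fun j => match j with
    | .left => p₁
    | .right => p₂
  let l : T ⟶ productTriangle F := productTriangle.lift F φ
  have hl₁ : l ≫ π₁ = p₁ := (productTriangle.isLimitFan F).fac (Fan.mk T φ) ⟨.left⟩
  have hl₂ : l ≫ π₂ = p₂ := (productTriangle.isLimitFan F).fac (Fan.mk T φ) ⟨.right⟩
  refine isomorphic_distinguished _ (productTriangle_distinguished F ?_) _
    ⟨l, π₁ ≫ i₁ + π₂ ≫ i₂, ?_, ?_⟩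
  · rintro (_ | _)
    exacts [h₁, h₂]
  · rw [Preadditive.comp_add, reassoc_of% hl₁, reassoc_of% hl₂, total]
  · refine Fan.IsLimit.hom_ext (productTriangle.isLimitFan F) _ _ ?_
    rintro (_ | _)
    · change ((π₁ ≫ i₁ + π₂ ≫ i₂) ≫ l) ≫ π₁ = 𝟙 _ ≫ π₁
      simp only [Preadditive.add_comp, assoc, hl₁, h₁₁, h₂₁, comp_id, comp_zero, add_zero, id_comp]
    · change ((π₁ ≫ i₁ + π₂ ≫ i₂) ≫ l) ≫ π₂ = 𝟙 _ ≫ π₂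
      simp only [Preadditive.add_comp, assoc, hl₂, h₁₂, h₂₂, comp_id, comp_zero, zero_add, id_comp]

section

variable {X Y Z X' Y' Z' : C} {a : X ⟶ Y} {b : Y ⟶ Z} {d : Z ⟶ X⟦(1 : ℤ)⟧}
  {a' : X' ⟶ Y'} {b' : Y' ⟶ Z'} {d' : Z' ⟶ X'⟦(1 : ℤ)⟧}

/-- An isomorphism between triangles given by explicit morphisms. -/
def triangleMkIso (e₁ : X ≅ X') (e₂ : Y ≅ Y') (e₃ : Z ≅ Z') (h₁ : a ≫ e₂.hom = e₁.hom ≫ a')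
    (h₂ : b ≫ e₃.hom = e₂.hom ≫ b') (h₃ : d ≫ e₁.hom⟦(1 : ℤ)⟧' = e₃.hom ≫ d') :
    Triangle.mk a b d ≅ Triangle.mk a' b' d' :=
  Triangle.isoMk _ _ e₁ e₂ e₃ h₁ h₂ h₃

lemma exists_triangleMk_hom₃ (h : Triangle.mk a b d ∈ distTriang C)
    (h' : Triangle.mk a' b' d' ∈ distTriang C) (f : X ⟶ X') (g : Y ⟶ Y')
    (comm : a ≫ g = f ≫ a') :
    ∃ k : Z ⟶ Z', b ≫ k = g ≫ b' ∧ d ≫ f⟦(1 : ℤ)⟧' = k ≫ d' :=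
  complete_distinguished_triangle_morphism _ _ h h' f g comm

lemma isIso₂_of_triangleMk (h : Triangle.mk a b d ∈ distTriang C)
    (h' : Triangle.mk a' b' d' ∈ distTriang C) (f : X ⟶ X') (g : Y ⟶ Y') (k : Z ⟶ Z')
    (comm₁ : a ≫ g = f ≫ a') (comm₂ : b ≫ k = g ≫ b') (comm₃ : d ≫ f⟦(1 : ℤ)⟧' = k ≫ d')
    (hf : IsIso f) (hk : IsIso k) : IsIso g :=
  Pretriangulated.isIso₂_of_isIso₁₃ (T := Triangle.mk a b d) (T' := Triangle.mk a' b' d')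
    ⟨f, g, k, comm₁, comm₂, comm₃⟩ h h' hf hk

lemma isIso₃_of_triangleMk (h : Triangle.mk a b d ∈ distTriang C)
    (h' : Triangle.mk a' b' d' ∈ distTriang C) (f : X ⟶ X') (g : Y ⟶ Y') (k : Z ⟶ Z')
    (comm₁ : a ≫ g = f ≫ a') (comm₂ : b ≫ k = g ≫ b') (comm₃ : d ≫ f⟦(1 : ℤ)⟧' = k ≫ d')
    (hf : IsIso f) (hg : IsIso g) : IsIso k :=
  Pretriangulated.isIso₃_of_isIso₁₂ (T := Triangle.mk a b d) (T' := Triangle.mk a' b' d')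
    ⟨f, g, k, comm₁, comm₂, comm₃⟩ h h' hf hg

/-- A retract, in the category of candidate triangles, of a distinguished triangle is
distinguished. -/
lemma distinguished_of_retract (hT' : Triangle.mk a' b' d' ∈ distTriang C)
    {i₁ : X ⟶ X'} {i₂ : Y ⟶ Y'} {i₃ : Z ⟶ Z'} {p₁ : X' ⟶ X} {p₂ : Y' ⟶ Y} {p₃ : Z' ⟶ Z}
    (hi₁ : a ≫ i₂ = i₁ ≫ a') (hi₂ : b ≫ i₃ = i₂ ≫ b') (hi₃ : d ≫ i₁⟦(1 : ℤ)⟧' = i₃ ≫ d')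
    (hp₁ : a' ≫ p₂ = p₁ ≫ a) (hp₂ : b' ≫ p₃ = p₂ ≫ b) (hp₃ : d' ≫ p₁⟦(1 : ℤ)⟧' = p₃ ≫ d)
    (e₁ : i₁ ≫ p₁ = 𝟙 X) (e₂ : i₂ ≫ p₂ = 𝟙 Y) (e₃ : i₃ ≫ p₃ = 𝟙 Z) :
    Triangle.mk a b d ∈ distTriang C := by
  obtain ⟨D, β, δ, hS⟩ := distinguished_cocone_triangle a
  obtain ⟨k, hk₂, hk₃⟩ := exists_triangleMk_hom₃ hS hT' i₁ i₂ hi₁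
  have z₁₂ : a ≫ β = 0 := comp_distTriang_mor_zero₁₂ _ hS
  have z₃₁' : d' ≫ a'⟦(1 : ℤ)⟧' = 0 := comp_distTriang_mor_zero₃₁ _ hT'
  have hq₂ : β ≫ k ≫ p₃ = b := by
    rw [reassoc_of% hk₂, hp₂, reassoc_of% e₂]
  have hq₃ : k ≫ p₃ ≫ d = δ := by
    rw [← hp₃, ← reassoc_of% hk₃, ← Functor.map_comp, e₁, Functor.map_id, comp_id]
  have exact₂ {W : C} (y : W ⟶ Y) (hy : y ≫ b = 0) : ∃ z : W ⟶ X, y = z ≫ a := by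
    obtain ⟨z : W ⟶ X', hz : y ≫ i₂ = z ≫ a'⟩ := Triangle.coyoneda_exact₂ _ hT' (y ≫ i₂)
      (show (y ≫ i₂) ≫ b' = 0 by rw [assoc, ← hi₂, reassoc_of% hy, zero_comp])
    exact ⟨z ≫ p₁, by rw [assoc, ← hp₁, ← reassoc_of% hz, e₂, comp_id]⟩
  have exact₃ {W : C} (y : W ⟶ Z) (hy : y ≫ d = 0) : ∃ z : W ⟶ Y, y = z ≫ b := by
    obtain ⟨z : W ⟶ Y', hz : y ≫ i₃ = z ≫ b'⟩ := Triangle.coyoneda_exact₃ _ hT' (y ≫ i₃)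
      (show (y ≫ i₃) ≫ d' = 0 by rw [assoc, ← hi₃, reassoc_of% hy, zero_comp])
    exact ⟨z ≫ p₂, by rw [assoc, ← hp₂, ← reassoc_of% hz, e₃, comp_id]⟩
  have z₃₁ : d ≫ a⟦(1 : ℤ)⟧' = 0 := by
    have : a = i₁ ≫ a' ≫ p₂ := by rw [hp₁, reassoc_of% e₁]
    rw [this, Functor.map_comp, Functor.map_comp, reassoc_of% hi₃,
      reassoc_of% z₃₁', zero_comp, comp_zero]
  have : IsIso (k ≫ p₃) := by
    refine isIso_of_yoneda_map_bijective _ fun W => ⟨fun f₁ f₂ hf => ?_, fun y => ?_⟩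
    · replace hf : f₁ ≫ k ≫ p₃ = f₂ ≫ k ≫ p₃ := hf
      rw [← sub_eq_zero, ← Preadditive.sub_comp] at hf
      rw [← sub_eq_zero]
      obtain ⟨y : W ⟶ Y, hy : f₁ - f₂ = y ≫ β⟩ := Triangle.coyoneda_exact₃ _ hS (f₁ - f₂)
        (show (f₁ - f₂) ≫ δ = 0 by
          rw [← hq₃, ← assoc k, ← assoc, hf, zero_comp])
      obtain ⟨z, rfl⟩ := exact₂ y (by rw [← hq₂, ← reassoc_of% hy, hf])
      rw [hy, assoc, z₁₂, comp_zero]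
    · obtain ⟨x : W ⟶ D, hx : y ≫ d = x ≫ δ⟩ := Triangle.coyoneda_exact₁ _ hS (y ≫ d)
        (show (y ≫ d) ≫ a⟦(1 : ℤ)⟧' = 0 by rw [assoc, z₃₁, comp_zero])
      obtain ⟨z, hz⟩ := exact₃ (y - x ≫ k ≫ p₃)
        (by rw [Preadditive.sub_comp, assoc, assoc, hq₃, hx, sub_self])
      refine ⟨x + z ≫ β, ?_⟩
      change (x + z ≫ β) ≫ k ≫ p₃ = y
      rw [Preadditive.add_comp, assoc z, hq₂, ← hz, add_sub_cancel]
  exact isomorphic_distinguished _ hS _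
    (triangleMkIso (Iso.refl _) (Iso.refl _) (asIso (k ≫ p₃))
      (by simp) (by simpa using hq₂) (by simpa using hq₃.symm)).symm

/-- A biproduct of two explicit distinguished triangles, in the category of candidate
triangles, is distinguished. -/
lemma distinguished_of_biproduct' {X'' Y'' Z'' : C} {a'' : X'' ⟶ Y''} {b'' : Y'' ⟶ Z''}
    {d'' : Z'' ⟶ X''⟦(1 : ℤ)⟧}
    (hT : Triangle.mk a b d ∈ distTriang C) (hT' : Triangle.mk a' b' d' ∈ distTriang C)
    {i₁ : X ⟶ X''} {i₂ : Y ⟶ Y''} {i₃ : Z ⟶ Z''} {j₁ : X' ⟶ X''} {j₂ : Y' ⟶ Y''} {j₃ : Z' ⟶ Z''}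
    {p₁ : X'' ⟶ X} {p₂ : Y'' ⟶ Y} {p₃ : Z'' ⟶ Z} {q₁ : X'' ⟶ X'} {q₂ : Y'' ⟶ Y'} {q₃ : Z'' ⟶ Z'}
    (hi₁ : a ≫ i₂ = i₁ ≫ a'') (hi₂ : b ≫ i₃ = i₂ ≫ b'') (hi₃ : d ≫ i₁⟦(1 : ℤ)⟧' = i₃ ≫ d'')
    (hj₁ : a' ≫ j₂ = j₁ ≫ a'') (hj₂ : b' ≫ j₃ = j₂ ≫ b'') (hj₃ : d' ≫ j₁⟦(1 : ℤ)⟧' = j₃ ≫ d'')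
    (hp₁ : a'' ≫ p₂ = p₁ ≫ a) (hp₂ : b'' ≫ p₃ = p₂ ≫ b) (hp₃ : d'' ≫ p₁⟦(1 : ℤ)⟧' = p₃ ≫ d)
    (hq₁ : a'' ≫ q₂ = q₁ ≫ a') (hq₂ : b'' ≫ q₃ = q₂ ≫ b') (hq₃ : d'' ≫ q₁⟦(1 : ℤ)⟧' = q₃ ≫ d')
    (ip₁ : i₁ ≫ p₁ = 𝟙 X) (ip₂ : i₂ ≫ p₂ = 𝟙 Y) (ip₃ : i₃ ≫ p₃ = 𝟙 Z)
    (jq₁ : j₁ ≫ q₁ = 𝟙 X') (jq₂ : j₂ ≫ q₂ = 𝟙 Y') (jq₃ : j₃ ≫ q₃ = 𝟙 Z')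
    (iq₁ : i₁ ≫ q₁ = 0) (iq₂ : i₂ ≫ q₂ = 0) (iq₃ : i₃ ≫ q₃ = 0)
    (jp₁ : j₁ ≫ p₁ = 0) (jp₂ : j₂ ≫ p₂ = 0) (jp₃ : j₃ ≫ p₃ = 0)
    (t₁ : p₁ ≫ i₁ + q₁ ≫ j₁ = 𝟙 X'') (t₂ : p₂ ≫ i₂ + q₂ ≫ j₂ = 𝟙 Y'')
    (t₃ : p₃ ≫ i₃ + q₃ ≫ j₃ = 𝟙 Z'') :
    Triangle.mk a'' b'' d'' ∈ distTriang C :=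
  distinguished_of_biproduct hT hT' (T := Triangle.mk a'' b'' d'')
    ⟨i₁, i₂, i₃, hi₁, hi₂, hi₃⟩ ⟨j₁, j₂, j₃, hj₁, hj₂, hj₃⟩
    ⟨p₁, p₂, p₃, hp₁, hp₂, hp₃⟩ ⟨q₁, q₂, q₃, hq₁, hq₂, hq₃⟩
    (TriangleMorphism.ext ip₁ ip₂ ip₃) (TriangleMorphism.ext iq₁ iq₂ iq₃)
    (TriangleMorphism.ext jp₁ jp₂ jp₃) (TriangleMorphism.ext jq₁ jq₂ jq₃)
    (TriangleMorphism.ext t₁ t₂ t₃)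

end

/-- The distinguished triangle on the projection of a biproduct to its second summand. -/
lemma biprod_snd_distinguished (A B : C) :
    Triangle.mk (biprod.snd : A ⊞ B ⟶ B) (0 : B ⟶ A⟦(1 : ℤ)⟧)
      ((biprod.inl : A ⟶ A ⊞ B)⟦(1 : ℤ)⟧') ∈ distTriang C := by
  have H : Triangle.mk (biprod.snd : A ⊞ B ⟶ B) (0 : B ⟶ A⟦(1 : ℤ)⟧)
      (-(biprod.inl : A ⟶ A ⊞ B)⟦(1 : ℤ)⟧') ∈ distTriang C :=
    rot_of_distTriang _ (binaryBiproductTriangle_distinguished A B)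
  exact isomorphic_distinguished _ H _
    (triangleMkIso (Iso.refl _) (Iso.refl _) ⟨-𝟙 _, -𝟙 _, by simp, by simp⟩
      (by simp) (by simp) (by simp))



section ShiftedBiproduct

variable {A B W : C}

@[simp]
lemma shift_biprod_inl_fst :
    (biprod.inl : A ⟶ A ⊞ B)⟦(1 : ℤ)⟧' ≫ (biprod.fst : A ⊞ B ⟶ A)⟦(1 : ℤ)⟧' = 𝟙 _ := by
  rw [← Functor.map_comp, biprod.inl_fst, Functor.map_id]

@[simp]
lemma shift_biprod_inl_snd :
    (biprod.inl : A ⟶ A ⊞ B)⟦(1 : ℤ)⟧' ≫ (biprod.snd : A ⊞ B ⟶ B)⟦(1 : ℤ)⟧' = 0 := by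
  rw [← Functor.map_comp, biprod.inl_snd, Functor.map_zero]

@[simp]
lemma shift_biprod_inr_fst :
    (biprod.inr : B ⟶ A ⊞ B)⟦(1 : ℤ)⟧' ≫ (biprod.fst : A ⊞ B ⟶ A)⟦(1 : ℤ)⟧' = 0 := by
  rw [← Functor.map_comp, biprod.inr_fst, Functor.map_zero]

@[simp]
lemma shift_biprod_inr_snd :
    (biprod.inr : B ⟶ A ⊞ B)⟦(1 : ℤ)⟧' ≫ (biprod.snd : A ⊞ B ⟶ B)⟦(1 : ℤ)⟧' = 𝟙 _ := by
  rw [← Functor.map_comp, biprod.inr_snd, Functor.map_id]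

@[simp]
lemma shift_biprod_inl_fst_assoc (k : A⟦(1 : ℤ)⟧ ⟶ W) :
    (biprod.inl : A ⟶ A ⊞ B)⟦(1 : ℤ)⟧' ≫ (biprod.fst : A ⊞ B ⟶ A)⟦(1 : ℤ)⟧' ≫ k = k := by
  rw [reassoc_of% shift_biprod_inl_fst (A := A) (B := B)]

@[simp]
lemma shift_biprod_inl_snd_assoc (k : B⟦(1 : ℤ)⟧ ⟶ W) :
    (biprod.inl : A ⟶ A ⊞ B)⟦(1 : ℤ)⟧' ≫ (biprod.snd : A ⊞ B ⟶ B)⟦(1 : ℤ)⟧' ≫ k = 0 := by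
  rw [reassoc_of% shift_biprod_inl_snd (A := A) (B := B), zero_comp]

@[simp]
lemma shift_biprod_inr_fst_assoc (k : A⟦(1 : ℤ)⟧ ⟶ W) :
    (biprod.inr : B ⟶ A ⊞ B)⟦(1 : ℤ)⟧' ≫ (biprod.fst : A ⊞ B ⟶ A)⟦(1 : ℤ)⟧' ≫ k = 0 := by
  rw [reassoc_of% shift_biprod_inr_fst (A := A) (B := B), zero_comp]

@[simp]
lemma shift_biprod_inr_snd_assoc (k : B⟦(1 : ℤ)⟧ ⟶ W) :
    (biprod.inr : B ⟶ A ⊞ B)⟦(1 : ℤ)⟧' ≫ (biprod.snd : A ⊞ B ⟶ B)⟦(1 : ℤ)⟧' ≫ k = k := by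
  rw [reassoc_of% shift_biprod_inr_snd (A := A) (B := B)]

lemma shift_biprod_total :
    (biprod.fst : A ⊞ B ⟶ A)⟦(1 : ℤ)⟧' ≫ (biprod.inl : A ⟶ A ⊞ B)⟦(1 : ℤ)⟧' +
      (biprod.snd : A ⊞ B ⟶ B)⟦(1 : ℤ)⟧' ≫ (biprod.inr : B ⟶ A ⊞ B)⟦(1 : ℤ)⟧' = 𝟙 _ := by
  rw [← Functor.map_comp, ← Functor.map_comp, ← Functor.map_add, biprod.total, Functor.map_id]

lemma shift_biprod_hom_ext {f g : W ⟶ (A ⊞ B)⟦(1 : ℤ)⟧}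
    (h₁ : f ≫ (biprod.fst : A ⊞ B ⟶ A)⟦(1 : ℤ)⟧' = g ≫ (biprod.fst : A ⊞ B ⟶ A)⟦(1 : ℤ)⟧')
    (h₂ : f ≫ (biprod.snd : A ⊞ B ⟶ B)⟦(1 : ℤ)⟧' = g ≫ (biprod.snd : A ⊞ B ⟶ B)⟦(1 : ℤ)⟧') :
    f = g := by
  rw [← comp_id f, ← comp_id g, ← shift_biprod_total, Preadditive.comp_add,
    Preadditive.comp_add, reassoc_of% h₁, reassoc_of% h₂]

lemma shift_biprod_hom_ext' {f g : (A ⊞ B)⟦(1 : ℤ)⟧ ⟶ W}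
    (h₁ : (biprod.inl : A ⟶ A ⊞ B)⟦(1 : ℤ)⟧' ≫ f = (biprod.inl : A ⟶ A ⊞ B)⟦(1 : ℤ)⟧' ≫ g)
    (h₂ : (biprod.inr : B ⟶ A ⊞ B)⟦(1 : ℤ)⟧' ≫ f = (biprod.inr : B ⟶ A ⊞ B)⟦(1 : ℤ)⟧' ≫ g) :
    f = g := by
  rw [← id_comp f, ← id_comp g, ← shift_biprod_total, Preadditive.add_comp,
    Preadditive.add_comp, assoc, assoc, assoc, assoc, h₁, h₂]

lemma shift_biprod_lift (f : W ⟶ A) (g : W ⟶ B) :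
    (biprod.lift f g)⟦(1 : ℤ)⟧' = f⟦(1 : ℤ)⟧' ≫ (biprod.inl : A ⟶ A ⊞ B)⟦(1 : ℤ)⟧' +
      g⟦(1 : ℤ)⟧' ≫ (biprod.inr : B ⟶ A ⊞ B)⟦(1 : ℤ)⟧' := by
  rw [biprod.lift_eq, Functor.map_add, Functor.map_comp, Functor.map_comp]

lemma shift_biprod_desc (f : A ⟶ W) (g : B ⟶ W) :
    (biprod.desc f g)⟦(1 : ℤ)⟧' = (biprod.fst : A ⊞ B ⟶ A)⟦(1 : ℤ)⟧' ≫ f⟦(1 : ℤ)⟧' +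
      (biprod.snd : A ⊞ B ⟶ B)⟦(1 : ℤ)⟧' ≫ g⟦(1 : ℤ)⟧' := by
  rw [biprod.desc_eq, Functor.map_add, Functor.map_comp, Functor.map_comp]

end ShiftedBiproduct

section

variable {X X'' Y Y'' Z' Z'' : C} {u : X ⟶ Y} {c : X'' ⟶ Y} {u'' : X'' ⟶ Y''}
  {v₁' : Y ⟶ Z'} {v₂' : Y'' ⟶ Z'} {w₁' : Z' ⟶ X⟦(1 : ℤ)⟧} {w₂' : Z' ⟶ X''⟦(1 : ℤ)⟧}
  {v'' : Y'' ⟶ Z''} {w'' : Z'' ⟶ X''⟦(1 : ℤ)⟧} {h : Z' ⟶ Z''}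

lemma rotated_summand_distinguished_iff :
    Triangle.mk (biprod.lift w₁' h) (biprod.desc (u⟦(1 : ℤ)⟧') (w'' ≫ c⟦(1 : ℤ)⟧'))
      (v₁'⟦(1 : ℤ)⟧') ∈ distTriang C ↔
    Triangle.mk (-v₁') (biprod.lift w₁' h) (biprod.desc (u⟦(1 : ℤ)⟧') (w'' ≫ c⟦(1 : ℤ)⟧')) ∈
      distTriang C := by
  rw [rotate_distinguished_triangle (Triangle.mk (-v₁') _ _)]
  have : v₁'⟦(1 : ℤ)⟧' = -(-v₁')⟦(1 : ℤ)⟧' := by rw [Functor.map_neg, neg_neg]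
  rw [this]
  rfl

lemma mappingCone_distinguished_iff
    (cv : c ≫ v₁' + u'' ≫ v₂' = 0) (wu : w'' ≫ u''⟦(1 : ℤ)⟧' = 0) (vw : v'' ≫ w'' = 0)
    (v₂w₁ : v₂' ≫ w₁' = 0)
    (hv₂ : v₂' ≫ h = v'') (hw : h ≫ w'' = w₂') :
    IsGood (Triangle.mk (biprod.desc (biprod.lift u 0) (biprod.lift c u''))
      (biprod.desc v₁' v₂')
      (biprod.lift w₁' w₂' ≫ ((shiftFunctor C (1 : ℤ)).mapBiprod X X'').inv))
      (Triangle.mk u'' v'' w'') biprod.snd biprod.snd h ↔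
    Triangle.mk (-v₁') (biprod.lift w₁' h) (biprod.desc (u⟦(1 : ℤ)⟧') (w'' ≫ c⟦(1 : ℤ)⟧')) ∈
      distTriang C := by
  let i₁ : Y ⟶ X'' ⊞ (Y ⊞ Y'') := biprod.inl ≫ biprod.inr
  let i₂ : Z' ⟶ Y'' ⊞ Z' := biprod.inr
  let i₃ : X⟦(1 : ℤ)⟧ ⊞ Z'' ⟶ Z'' ⊞ (X ⊞ X'')⟦(1 : ℤ)⟧ :=
    biprod.desc (biprod.lift 0 (-biprod.inl⟦(1 : ℤ)⟧'))
      (biprod.lift (𝟙 _) (-(w'' ≫ biprod.inr⟦(1 : ℤ)⟧')))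
  let p₁ : X'' ⊞ (Y ⊞ Y'') ⟶ Y := biprod.desc c biprod.fst
  let p₂ : Y'' ⊞ Z' ⟶ Z' := biprod.desc v₂' (𝟙 _)
  let p₃ : Z'' ⊞ (X ⊞ X'')⟦(1 : ℤ)⟧ ⟶ X⟦(1 : ℤ)⟧ ⊞ Z'' :=
    biprod.desc (biprod.lift 0 (𝟙 _)) (biprod.lift (-biprod.fst⟦(1 : ℤ)⟧') 0)
  let j₁ : X'' ⊞ Y'' ⟶ X'' ⊞ (Y ⊞ Y'') :=
    biprod.desc (biprod.lift (𝟙 _) (biprod.lift (-c) (-u''))) (biprod.lift 0 biprod.inr)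
  let j₂ : Y'' ⟶ Y'' ⊞ Z' := biprod.lift (𝟙 _) (-v₂')
  let j₃ : X''⟦(1 : ℤ)⟧ ⟶ Z'' ⊞ (X ⊞ X'')⟦(1 : ℤ)⟧ := biprod.lift 0 (biprod.inr⟦(1 : ℤ)⟧')
  let q₁ : X'' ⊞ (Y ⊞ Y'') ⟶ X'' ⊞ Y'' :=
    biprod.desc (biprod.lift (𝟙 _) u'') (biprod.snd ≫ biprod.inr)
  let q₂ : Y'' ⊞ Z' ⟶ Y'' := biprod.fst
  let q₃ : Z'' ⊞ (X ⊞ X'')⟦(1 : ℤ)⟧ ⟶ X''⟦(1 : ℤ)⟧ := biprod.desc w'' (biprod.snd⟦(1 : ℤ)⟧')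
  let m₁ : X'' ⊞ (Y ⊞ Y'') ⟶ Y'' ⊞ Z' :=
    biprod.desc (biprod.lift u'' 0) (biprod.lift biprod.snd (-biprod.desc v₁' v₂'))
  let m₂ : Y'' ⊞ Z' ⟶ Z'' ⊞ (X ⊞ X'')⟦(1 : ℤ)⟧ :=
    biprod.desc (biprod.lift v'' 0) (biprod.lift h (-(biprod.lift w₁' w₂' ≫
      biprod.desc (biprod.inl⟦(1 : ℤ)⟧') (biprod.inr⟦(1 : ℤ)⟧'))))
  let m₃ : Z'' ⊞ (X ⊞ X'')⟦(1 : ℤ)⟧ ⟶ (X'' ⊞ (Y ⊞ Y''))⟦(1 : ℤ)⟧ :=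
    biprod.desc (biprod.lift w'' 0) (biprod.lift (biprod.snd⟦(1 : ℤ)⟧')
      (-(biprod.desc (biprod.lift u 0) (biprod.lift c u'') : X ⊞ X'' ⟶ Y ⊞ Y'')⟦(1 : ℤ)⟧')) ≫
      biprod.desc (biprod.inl⟦(1 : ℤ)⟧') (biprod.inr⟦(1 : ℤ)⟧')
  have uv : u'' ≫ v₂' = -(c ≫ v₁') := by rw [eq_neg_iff_add_eq_zero, add_comm, cv]
  have v₂w₂ : v₂' ≫ w₂' = 0 := by rw [← hw, reassoc_of% hv₂, vw]
  have hi₁ : (-v₁') ≫ i₂ = i₁ ≫ m₁ := by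
    ext <;> simp [i₂, i₁, m₁]
  have hi₂ : biprod.lift w₁' h ≫ i₃ = i₂ ≫ m₂ := by
    ext
    · simp [i₂, i₃, m₂]
    · apply shift_biprod_hom_ext <;> simp [i₂, i₃, m₂, reassoc_of% hw]
  have hi₃ : biprod.desc (u⟦(1 : ℤ)⟧') (w'' ≫ c⟦(1 : ℤ)⟧') ≫ i₁⟦(1 : ℤ)⟧' = i₃ ≫ m₃ := by
    ext <;> refine shift_biprod_hom_ext ?_ (shift_biprod_hom_ext ?_ ?_) <;>
      simp [i₁, i₃, m₃, shift_biprod_lift, shift_biprod_desc, wu]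
  have hj₁ : biprod.snd ≫ j₂ = j₁ ≫ m₁ := by
    ext <;> simp [j₁, j₂, m₁, uv]
  have hj₂ : 0 ≫ j₃ = j₂ ≫ m₂ := by
    ext
    · simp [j₂, m₂, hv₂]
    · apply shift_biprod_hom_ext <;> simp [j₂, m₂, v₂w₁, v₂w₂]
  have hj₃ : biprod.inl⟦(1 : ℤ)⟧' ≫ j₁⟦(1 : ℤ)⟧' = j₃ ≫ m₃ := by
    refine shift_biprod_hom_ext ?_ (shift_biprod_hom_ext ?_ ?_) <;>
      simp [j₁, j₃, m₃, shift_biprod_lift, shift_biprod_desc]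
  have hp₁ : m₁ ≫ p₂ = p₁ ≫ (-v₁') := by
    ext <;> simp [m₁, p₁, p₂, uv]
  have hp₂ : m₂ ≫ p₃ = p₂ ≫ biprod.lift w₁' h := by
    ext <;> simp [m₂, p₂, p₃, hv₂, v₂w₁]
  have hp₃ : m₃ ≫ p₁⟦(1 : ℤ)⟧' =
      p₃ ≫ biprod.desc (u⟦(1 : ℤ)⟧') (w'' ≫ c⟦(1 : ℤ)⟧') := by
    ext
    · simp [m₃, p₁, p₃, shift_biprod_desc]
    · apply shift_biprod_hom_ext' <;>
        simp [m₃, p₁, p₃, shift_biprod_lift, shift_biprod_desc]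
  have hq₁ : m₁ ≫ q₂ = q₁ ≫ biprod.snd := by
    ext <;> simp [m₁, q₁, q₂]
  have hq₂ : m₂ ≫ q₃ = q₂ ≫ 0 := by
    ext <;> simp [m₂, q₂, q₃, vw, hw]
  have hq₃ : m₃ ≫ q₁⟦(1 : ℤ)⟧' = q₃ ≫ biprod.inl⟦(1 : ℤ)⟧' := by
    ext
    · apply shift_biprod_hom_ext <;>
        simp [m₃, q₁, q₃, shift_biprod_desc, shift_biprod_lift, wu]
    · apply shift_biprod_hom_ext' <;> apply shift_biprod_hom_ext <;>
        simp [m₃, q₁, q₃, shift_biprod_lift, shift_biprod_desc]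
  have ip₁ : i₁ ≫ p₁ = 𝟙 _ := by simp [i₁, p₁]
  have ip₂ : i₂ ≫ p₂ = 𝟙 _ := by simp [i₂, p₂]
  have ip₃ : i₃ ≫ p₃ = 𝟙 _ := by ext <;> simp [i₃, p₃]
  constructor
  · intro H
    exact distinguished_of_retract (a' := m₁) (b' := m₂) (d' := m₃) H
      hi₁ hi₂ hi₃ hp₁ hp₂ hp₃ ip₁ ip₂ ip₃
  · intro H
    refine distinguished_of_biproduct' (a'' := m₁) (b'' := m₂) (d'' := m₃) H
      (biprod_snd_distinguished X'' Y'') hi₁ hi₂ hi₃ hj₁ hj₂ hj₃ hp₁ hp₂ hp₃ hq₁ hq₂ hq₃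
      ip₁ ip₂ ip₃ ?_ ?_ ?_ ?_ ?_ ?_ ?_ ?_ ?_ ?_ ?_ ?_
    · ext <;> simp [j₁, q₁]
    · simp [j₂, q₂]
    · simp [j₃, q₃]
    · ext <;> simp [i₁, q₁]
    · simp [i₂, q₂]
    · ext <;> simp [i₃, q₃]
    · ext <;> simp [j₁, p₁]
    · simp [j₂, p₂]
    · ext <;> simp [j₃, p₃]
    · ext <;> simp [i₁, j₁, p₁, q₁]
    · ext <;> simp [i₂, j₂, p₂, q₂]
    · ext
      · simp [i₃, j₃, p₃, q₃]
      · simp [i₃, j₃, p₃, q₃]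
      · simp [i₃, j₃, p₃, q₃]
      · apply shift_biprod_hom_ext' <;> apply shift_biprod_hom_ext <;>
          simp [i₃, j₃, p₃, q₃]

lemma rotated_summand_distinguished_of_split
    (hT' : Triangle.mk (biprod.desc (biprod.lift u 0) (biprod.lift 0 u''))
      (biprod.desc v₁' v₂') (biprod.lift w₁' w₂' ≫
        biprod.desc (biprod.inl⟦(1 : ℤ)⟧') (biprod.inr⟦(1 : ℤ)⟧')) ∈ distTriang C)
    (hT'' : Triangle.mk u'' v'' w'' ∈ distTriang C)
    (hv₁ : v₁' ≫ h = 0) (hv₂ : v₂' ≫ h = v'') (hw : h ≫ w'' = w₂') :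
    Triangle.mk (-v₁') (biprod.lift w₁' h) (biprod.desc (u⟦(1 : ℤ)⟧') 0) ∈ distTriang C := by
  obtain ⟨Z, v, w, hu⟩ := distinguished_cocone_triangle u
  obtain ⟨k, hk₂, hk₃⟩ := exists_triangleMk_hom₃ hT' hu biprod.fst biprod.fst
    (by ext <;> simp)
  have hkw : k ≫ w = w₁' := by rw [← hk₃]; simp
  have hvk₁ : v₁' ≫ k = v := by simpa using biprod.inl ≫= hk₂
  have hvk₂ : v₂' ≫ k = 0 := by simpa using biprod.inr ≫= hk₂
  have hS : Triangle.mk (biprod.desc (biprod.lift u 0) (biprod.lift 0 u'') :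
      X ⊞ X'' ⟶ Y ⊞ Y'') (biprod.map v v'') (biprod.desc (w ≫ biprod.inl⟦(1 : ℤ)⟧')
        (w'' ≫ biprod.inr⟦(1 : ℤ)⟧')) ∈ distTriang C := by
    refine distinguished_of_biproduct' hu hT'' (i₁ := biprod.inl) (i₂ := biprod.inl)
      (i₃ := biprod.inl) (j₁ := biprod.inr) (j₂ := biprod.inr) (j₃ := biprod.inr)
      (p₁ := biprod.fst) (p₂ := biprod.fst) (p₃ := biprod.fst)
      (q₁ := biprod.snd) (q₂ := biprod.snd) (q₃ := biprod.snd)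
      ?_ ?_ ?_ ?_ ?_ ?_ ?_ ?_ ?_ ?_ ?_ ?_ ?_ ?_ ?_ ?_ ?_ ?_ ?_ ?_ ?_ ?_ ?_ ?_ ?_ ?_ ?_ <;>
      first
      | (simp [biprod.total]; done)
      | (ext <;> simp)
  have : IsIso (biprod.lift k h) := by
    refine isIso₃_of_triangleMk hT' hS (𝟙 _) (𝟙 _) _ (by simp) ?_ ?_
      (IsIso.id _) (IsIso.id _)
    · ext <;> simp [hvk₁, hvk₂, hv₁, hv₂]
    · apply shift_biprod_hom_ext <;> simp [reassoc_of% hkw, reassoc_of% hw]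
  have hR : Triangle.mk (-v) w (u⟦(1 : ℤ)⟧') ∈ distTriang C := by
    have H : Triangle.mk v w (-u⟦(1 : ℤ)⟧') ∈ distTriang C := rot_of_distTriang _ hu
    exact isomorphic_distinguished _ H _
      (triangleMkIso ⟨-𝟙 _, -𝟙 _, by simp, by simp⟩ (Iso.refl _) (Iso.refl _)
        (by simp) (by simp) (by simp))
  have hQ : Triangle.mk (biprod.lift (-v) (0 : Y ⟶ Z'')) (biprod.map w (𝟙 Z''))
      (biprod.desc (u⟦(1 : ℤ)⟧') 0) ∈ distTriang C := by
    refine distinguished_of_biproduct' hR (contractible_distinguished₁ Z'')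
      (i₁ := 𝟙 _) (i₂ := biprod.inl) (i₃ := biprod.inl)
      (j₁ := 0) (j₂ := biprod.inr) (j₃ := biprod.inr)
      (p₁ := 𝟙 _) (p₂ := biprod.fst) (p₃ := biprod.fst)
      (q₁ := 0) (q₂ := biprod.snd) (q₃ := biprod.snd)
      ?_ ?_ ?_ ?_ ?_ ?_ ?_ ?_ ?_ ?_ ?_ ?_ ?_ ?_ ?_ ?_ ?_ ?_ ?_ ?_ ?_ ?_ ?_ ?_ ?_ ?_ ?_ <;>
      first
      | (simp [biprod.total]; done)
      | (ext <;> simp)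
  refine isomorphic_distinguished _ hQ _
    (triangleMkIso (Iso.refl _) (asIso (biprod.lift k h)) (Iso.refl _) ?_ ?_ ?_)
  · ext <;> simp [hvk₁, hv₁]
  · ext <;> simp [hkw]
  · simp

lemma exists_iso_of_biprod_snd_distinguished {A B U : C} {f' : B ⟶ U}
    {f'' : U ⟶ (A ⊞ B)⟦(1 : ℤ)⟧}
    (hf : Triangle.mk (biprod.snd : A ⊞ B ⟶ B) f' f'' ∈ distTriang C) :
    ∃ θ : U ≅ A⟦(1 : ℤ)⟧, f'' = θ.hom ≫ biprod.inl⟦(1 : ℤ)⟧' := by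
  obtain ⟨k, hk₂, hk₃⟩ := exists_triangleMk_hom₃ hf (biprod_snd_distinguished A B) (𝟙 _) (𝟙 _)
    (by simp)
  have : IsIso k := isIso₃_of_triangleMk hf (biprod_snd_distinguished A B) _ _ _
    (by simp) hk₂ hk₃ (IsIso.id _) (IsIso.id _)
  exact ⟨asIso k, by simpa using hk₃⟩

lemma isVerdierGood_of_summand_distinguished
    (vw : v'' ≫ w'' = 0) (wu : w'' ≫ u''⟦(1 : ℤ)⟧' = 0) (uv : u'' ≫ v'' = 0)
    (v₁w₁ : v₁' ≫ w₁' = 0) (v₂w₁ : v₂' ≫ w₁' = 0)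
    (hT'' : Triangle.mk u'' v'' w'' ∈ distTriang C)
    (hv₁ : v₁' ≫ h = 0) (hv₂ : v₂' ≫ h = v'') (hw : h ≫ w'' = w₂')
    (H : Triangle.mk (biprod.lift w₁' h) (biprod.desc (u⟦(1 : ℤ)⟧') (w'' ≫ c⟦(1 : ℤ)⟧'))
      (v₁'⟦(1 : ℤ)⟧') ∈ distTriang C) :
    IsVerdierGood (Triangle.mk (biprod.desc (biprod.lift u 0) (biprod.lift c u''))
      (biprod.desc v₁' v₂') (biprod.lift w₁' w₂' ≫
        biprod.desc (biprod.inl⟦(1 : ℤ)⟧') (biprod.inr⟦(1 : ℤ)⟧')))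
      (Triangle.mk u'' v'' w'') biprod.snd biprod.snd h := by
  have h₀ : Triangle.mk ((biprod.desc (biprod.lift u 0) (biprod.lift c u'') :
      X ⊞ X'' ⟶ Y ⊞ Y'') ≫ biprod.snd) (biprod.lift (0 : Y'' ⟶ X⟦(1 : ℤ)⟧) v'')
      (biprod.desc (biprod.inl⟦(1 : ℤ)⟧') (w'' ≫ biprod.inr⟦(1 : ℤ)⟧')) ∈ distTriang C := by
    refine distinguished_of_biproduct' hT'' (contractible_distinguished₂ X)
      (i₁ := biprod.inr) (i₂ := 𝟙 _) (i₃ := biprod.inr)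
      (j₁ := biprod.inl) (j₂ := 0) (j₃ := biprod.inl)
      (p₁ := biprod.snd) (p₂ := 𝟙 _) (p₃ := biprod.snd)
      (q₁ := biprod.fst) (q₂ := 0) (q₃ := biprod.fst)
      ?_ ?_ ?_ ?_ ?_ ?_ ?_ ?_ ?_ ?_ ?_ ?_ ?_ ?_ ?_ ?_ ?_ ?_ ?_ ?_ ?_ ?_ ?_ ?_ ?_ ?_ ?_ <;>
      first
      | (simp; done)
      | (ext <;> simp)
  have o₁ : IsOctahedron (biprod.desc (biprod.lift u 0) (biprod.lift c u'') :
      X ⊞ X'' ⟶ Y ⊞ Y'') biprod.snd (biprod.desc v₁' v₂') (biprod.lift w₁' w₂' ≫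
        biprod.desc (biprod.inl⟦(1 : ℤ)⟧') (biprod.inr⟦(1 : ℤ)⟧')) (0 : Y'' ⟶ Y⟦(1 : ℤ)⟧)
      ((biprod.inl : Y ⟶ Y ⊞ Y'')⟦(1 : ℤ)⟧') (biprod.lift 0 v'')
      (biprod.desc (biprod.inl⟦(1 : ℤ)⟧') (w'' ≫ biprod.inr⟦(1 : ℤ)⟧'))
      (biprod.lift w₁' h) (biprod.desc (u⟦(1 : ℤ)⟧') (w'' ≫ c⟦(1 : ℤ)⟧')) := by
    refine ⟨?_, ?_, ?_, ?_, ?_⟩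
    · ext <;> simp [v₁w₁, v₂w₁, hv₁, hv₂]
    · simp [reassoc_of% hw]
    · simp [reassoc_of% vw]
    · ext <;> simp [shift_biprod_desc, shift_biprod_lift, reassoc_of% wu]
    · rwa [← Functor.map_comp, biprod.inl_desc]
  have o₂ : IsOctahedron (biprod.snd : X ⊞ X'' ⟶ X'') u'' (0 : X'' ⟶ X⟦(1 : ℤ)⟧)
      ((biprod.inl : X ⟶ X ⊞ X'')⟦(1 : ℤ)⟧') v'' w'' (biprod.lift 0 v'')
      (biprod.desc (biprod.inl⟦(1 : ℤ)⟧') (w'' ≫ biprod.inr⟦(1 : ℤ)⟧'))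
      biprod.inl biprod.snd := by
    refine ⟨?_, ?_, ?_, ?_, ?_⟩
    · ext <;> simp [uv]
    · simp
    · simp
    · ext <;> simp
    · rw [Functor.map_zero, comp_zero]
      exact binaryBiproductTriangle_distinguished _ _
  exact ⟨_, _, _, _, _, _, _, _, _, _, _, _, _, h₀, biprod_snd_distinguished Y Y'',
    biprod_snd_distinguished X X'', o₁, o₂, (biprod.lift_snd _ _).symm⟩

lemma summand_distinguished_of_octahedra {A U V : C}
    {vt : Y'' ⟶ A} {wt : A ⟶ (X ⊞ X'')⟦(1 : ℤ)⟧}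
    {g' : Y'' ⟶ V} {g'' : V ⟶ (Y ⊞ Y'')⟦(1 : ℤ)⟧} {f' : X'' ⟶ U} {f'' : U ⟶ (X ⊞ X'')⟦(1 : ℤ)⟧}
    {α₁ : Z' ⟶ A} {β₁ : A ⟶ V} {α₂ : U ⟶ A} {β₂ : A ⟶ Z''}
    (hg : Triangle.mk (biprod.snd : Y ⊞ Y'' ⟶ Y'') g' g'' ∈ distTriang C)
    (hf : Triangle.mk (biprod.snd : X ⊞ X'' ⟶ X'') f' f'' ∈ distTriang C)
    (o₁ : IsOctahedron (biprod.desc (biprod.lift u 0) (biprod.lift c u'')) biprod.snd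
      (biprod.desc v₁' v₂') (biprod.lift w₁' w₂' ≫
        biprod.desc (biprod.inl⟦(1 : ℤ)⟧') (biprod.inr⟦(1 : ℤ)⟧')) g' g'' vt wt α₁ β₁)
    (o₂ : IsOctahedron biprod.snd u'' f' f'' v'' w'' vt wt α₂ β₂) :
    Triangle.mk (biprod.lift w₁' (α₁ ≫ β₂))
      (biprod.desc (u⟦(1 : ℤ)⟧') (w'' ≫ c⟦(1 : ℤ)⟧')) (v₁'⟦(1 : ℤ)⟧') ∈ distTriang C := by
  obtain ⟨-, h₁₂, -, h₁₄, h₁₅⟩ := o₁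
  obtain ⟨-, h₂₂, -, h₂₄, h₂₅⟩ := o₂
  obtain ⟨θ, rfl⟩ := exists_iso_of_biprod_snd_distinguished hg
  obtain ⟨η, rfl⟩ := exists_iso_of_biprod_snd_distinguished hf
  have z : f' = 0 := by
    have : (biprod.snd : X ⊞ X'' ⟶ X'') ≫ f' = 0 := comp_distTriang_mor_zero₁₂ _ hf
    simpa using biprod.inr ≫= this
  have αβ : α₂ ≫ β₂ = 0 := comp_distTriang_mor_zero₁₂ _ h₂₅
  have : IsIso (biprod.lift (wt ≫ biprod.fst⟦(1 : ℤ)⟧') β₂) := by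
    rw [z, Functor.map_zero, comp_zero] at h₂₅
    refine isIso₂_of_triangleMk h₂₅ (binaryBiproductTriangle_distinguished _ _) η.hom _ (𝟙 _)
      ?_ ?_ ?_ inferInstance (IsIso.id _)
    · ext <;> simp [reassoc_of% h₂₂, αβ]
    · simp
    · simp
  refine isomorphic_distinguished _ h₁₅ _ (triangleMkIso (Iso.refl _)
    (asIso (biprod.lift (wt ≫ biprod.fst⟦(1 : ℤ)⟧') β₂)) θ ?_ ?_ ?_).symm
  · ext <;> simp [reassoc_of% h₁₂]
  · have := h₁₄ =≫ biprod.fst⟦(1 : ℤ)⟧'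
    simp only [assoc, shift_biprod_inl_fst, comp_id] at this
    simp [this, shift_biprod_desc, shift_biprod_lift, reassoc_of% h₂₄]
  · simp [shift_biprod_desc]

end

end CategoryTheory.Pretriangulated

theorem stmt_5 {X X'' Y Y'' Z' Z'' : C}
    (u : X ⟶ Y) (c : X'' ⟶ Y) (u'' : X'' ⟶ Y'')
    (v₁' : Y ⟶ Z') (v₂' : Y'' ⟶ Z')
    (w₁' : Z' ⟶ X⟦(1 : ℤ)⟧) (w₂' : Z' ⟶ X''⟦(1 : ℤ)⟧)
    (v'' : Y'' ⟶ Z'') (w'' : Z'' ⟶ X''⟦(1 : ℤ)⟧)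
    (hT' : (Triangle.mk (biprod.desc (biprod.lift u 0) (biprod.lift c u''))
      (biprod.desc v₁' v₂')
      (biprod.lift w₁' w₂' ≫ ((shiftFunctor C (1 : ℤ)).mapBiprod X X'').inv)) ∈ distTriang C)
    (hT'' : Triangle.mk u'' v'' w'' ∈ distTriang C)
    (h : Z' ⟶ Z'')
    (hmap : IsTriMap (Triangle.mk (biprod.desc (biprod.lift u 0) (biprod.lift c u''))
      (biprod.desc v₁' v₂')
      (biprod.lift w₁' w₂' ≫ ((shiftFunctor C (1 : ℤ)).mapBiprod X X'').inv)) (Triangle.mk u'' v'' w'') biprod.snd biprod.snd h) :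
    (IsGood (Triangle.mk (biprod.desc (biprod.lift u 0) (biprod.lift c u''))
      (biprod.desc v₁' v₂')
      (biprod.lift w₁' w₂' ≫ ((shiftFunctor C (1 : ℤ)).mapBiprod X X'').inv)) (Triangle.mk u'' v'' w'') biprod.snd biprod.snd h ↔
      IsVerdierGood (Triangle.mk (biprod.desc (biprod.lift u 0) (biprod.lift c u''))
      (biprod.desc v₁' v₂')
      (biprod.lift w₁' w₂' ≫ ((shiftFunctor C (1 : ℤ)).mapBiprod X X'').inv)) (Triangle.mk u'' v'' w'') biprod.snd biprod.snd h) ∧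
    (IsGood (Triangle.mk (biprod.desc (biprod.lift u 0) (biprod.lift c u''))
      (biprod.desc v₁' v₂')
      (biprod.lift w₁' w₂' ≫ ((shiftFunctor C (1 : ℤ)).mapBiprod X X'').inv)) (Triangle.mk u'' v'' w'') biprod.snd biprod.snd h ↔
      (Triangle.mk (biprod.lift w₁' h)
        (biprod.desc (u⟦(1 : ℤ)⟧') (w'' ≫ c⟦(1 : ℤ)⟧')) (v₁'⟦(1 : ℤ)⟧') ∈ distTriang C)) ∧
    (c = 0 → IsGood (Triangle.mk (biprod.desc (biprod.lift u 0) (biprod.lift c u''))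
      (biprod.desc v₁' v₂')
      (biprod.lift w₁' w₂' ≫ ((shiftFunctor C (1 : ℤ)).mapBiprod X X'').inv)) (Triangle.mk u'' v'' w'') biprod.snd biprod.snd h) := by
  have hD : Triangle.mk (biprod.desc (biprod.lift u 0) (biprod.lift c u''))
      (biprod.desc v₁' v₂') (biprod.lift w₁' w₂' ≫
        biprod.desc (biprod.inl⟦(1 : ℤ)⟧') (biprod.inr⟦(1 : ℤ)⟧')) ∈ distTriang C := hT'
  have hm₂ : biprod.desc v₁' v₂' ≫ h = biprod.snd ≫ v'' := hmap.2.1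
  have hm₃ : (biprod.lift w₁' w₂' ≫
      biprod.desc (biprod.inl⟦(1 : ℤ)⟧') (biprod.inr⟦(1 : ℤ)⟧')) ≫
        (biprod.snd : X ⊞ X'' ⟶ X'')⟦(1 : ℤ)⟧' = h ≫ w'' := hmap.2.2
  have z₁₂ : (biprod.desc (biprod.lift u 0) (biprod.lift c u'') : X ⊞ X'' ⟶ Y ⊞ Y'') ≫
      biprod.desc v₁' v₂' = 0 := comp_distTriang_mor_zero₁₂ _ hD
  have z₂₃ : biprod.desc v₁' v₂' ≫ biprod.lift w₁' w₂' ≫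
      biprod.desc (biprod.inl⟦(1 : ℤ)⟧') (biprod.inr⟦(1 : ℤ)⟧') = 0 :=
    comp_distTriang_mor_zero₂₃ _ hD
  have hv₁ : v₁' ≫ h = 0 := by simpa using biprod.inl ≫= hm₂
  have hv₂ : v₂' ≫ h = v'' := by simpa using biprod.inr ≫= hm₂
  have hw : h ≫ w'' = w₂' := by rw [← hm₃]; simp
  have cv : c ≫ v₁' + u'' ≫ v₂' = 0 := by simpa using biprod.inr ≫= z₁₂
  have v₁w₁ : v₁' ≫ w₁' = 0 := by
    simpa using biprod.inl ≫= z₂₃ =≫ (biprod.fst : X ⊞ X'' ⟶ X)⟦(1 : ℤ)⟧'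
  have v₂w₁ : v₂' ≫ w₁' = 0 := by
    simpa using biprod.inr ≫= z₂₃ =≫ (biprod.fst : X ⊞ X'' ⟶ X)⟦(1 : ℤ)⟧'
  have uv : u'' ≫ v'' = 0 := comp_distTriang_mor_zero₁₂ _ hT''
  have vw : v'' ≫ w'' = 0 := comp_distTriang_mor_zero₂₃ _ hT''
  have wu : w'' ≫ u''⟦(1 : ℤ)⟧' = 0 := comp_distTriang_mor_zero₃₁ _ hT''
  have hgood := mappingCone_distinguished_iff (u := u) cv wu vw v₂w₁ hv₂ hw
  have hrot := rotated_summand_distinguished_iff (u := u) (c := c) (v₁' := v₁') (w₁' := w₁')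
    (w'' := w'') (h := h)
  refine ⟨?_, hgood.trans hrot.symm, ?_⟩
  · rw [hgood, ← hrot]
    refine ⟨isVerdierGood_of_summand_distinguished vw wu uv v₁w₁ v₂w₁ hT'' hv₁ hv₂ hw, ?_⟩
    rintro ⟨A, V, U, vt, wt, g', g'', f', f'', α₁, β₁, α₂, β₂, -, hg, hf, o₁, o₂, rfl⟩
    exact summand_distinguished_of_octahedra hg hf o₁ o₂
  · rintro rfl
    rw [hgood, Functor.map_zero, comp_zero]
    exact rotated_summand_distinguished_of_split hD hT'' hv₁ hv₂ hw
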